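/- Let p be an odd prime. Define ε_p = (2p − a_{-1,p}^2)^2 if p ≡ 1 (mod 4) and ε_p = 0 if p ≡ 3 (mod 4). Then #{(t,x_0,…,x_5) ∈ F_p^7 : (x_0,…,x_5) ≠ (0,…,0) and t^2 = ∏_{i=0}^{5} x_i·(x_i + x_{i+1})} = (p−1)·( Σ_{i=0}^{5} p^i + ε_p + Σ_{λ ∈ F_p, λ ≠ 0, λ ≠ -1} φ(λ)·(a_{λ,p}^2 − p)^2 ), where indices are read modulo 6 (so x_6 = x_0). -/

import Mathlib

open scoped BigOperators

section helpers
set_option linter.unusedSectionVars false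
variable {F : Type*} [Field F] [Fintype F] [DecidableEq F]

lemma chi_eq {c x y : F} (hc : c ≠ 0) (e : y = c ^ 2 * x) :
    quadraticChar F y = quadraticChar F x := by
  rw [e, map_mul, quadraticChar_sq_one' hc, one_mul]

lemma chi_mul_self {c : F} (hc : c ≠ 0) : quadraticChar F c * quadraticChar F c = 1 := by
  rw [← sq, quadraticChar_sq_one hc]

lemma cnt_sq (hF : ringChar F ≠ 2) (a : F) :
    ∑ x : F, (if x ^ 2 = a then (1 : ℤ) else 0) = 1 + quadraticChar F a := by
  have h := quadraticChar_card_sqrts hF a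
  rw [add_comm, ← h]
  simp

lemma two_ne (hF : ringChar F ≠ 2) : (2 : F) ≠ 0 := Ring.two_ne_zero hF

lemma sum_affine {M : Type*} [AddCommMonoid M] (f : F → M) {a : F} (ha : a ≠ 0) (b : F) :
    ∑ x : F, f (a * x + b) = ∑ x : F, f x :=
  Fintype.sum_equiv ((Equiv.mulLeft₀ a ha).trans (Equiv.addRight b)) _ _ (fun x => by simp)

lemma cnt_quad (hF : ringChar F ≠ 2) {α : F} (hα : α ≠ 0) (β γ : F) :
    ∑ x : F, (if α * x ^ 2 + β * x + γ = 0 then (1 : ℤ) else 0)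
      = 1 + quadraticChar F (β ^ 2 - 4 * α * γ) := by
  have h2 := two_ne hF
  rw [← cnt_sq hF, ← sum_affine (fun x => if x ^ 2 = _ then (1 : ℤ) else 0) (mul_ne_zero h2 hα) β]
  refine Finset.sum_congr rfl fun x _ => ?_
  congr 1
  have h4 : 4 * α ≠ 0 := by
    have : (4 : F) = 2 * 2 := by norm_num
    rw [this]; exact mul_ne_zero (mul_ne_zero h2 h2) hα
  rw [eq_iff_iff]
  constructor
  · intro h; linear_combination 4 * α * h
  · intro h; apply (mul_eq_zero.mp _).resolve_left h4
    linear_combination h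

lemma sum_sq (hF : ringChar F ≠ 2) (f : F → ℤ) :
    ∑ x : F, f (x ^ 2) = ∑ z : F, f z * (1 + quadraticChar F z) := by
  simp_rw [← cnt_sq hF, Finset.mul_sum]
  rw [Finset.sum_comm]
  refine Finset.sum_congr rfl fun x _ => ?_
  simp

lemma sum_inv (f : F → ℤ) : ∑ x : F, f x⁻¹ = ∑ x : F, f x :=
  Fintype.sum_equiv (inv_involutive (G := F)).toPerm _ _ (fun x => by simp)

lemma sum_ne {f : F → ℤ} {c : F} : ∑ x : F, (if x = c then 0 else f x) = (∑ x : F, f x) - f c := by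
  rw [← Finset.sum_erase_add _ _ (Finset.mem_univ c), ← Finset.sum_erase_add (a := c) _ f (Finset.mem_univ c)]
  simp only [if_true, add_zero, add_sub_cancel_right]
  exact Finset.sum_congr rfl fun x hx => if_neg (Finset.ne_of_mem_erase hx)

lemma sum_chi_affine (hF : ringChar F ≠ 2) {a : F} (ha : a ≠ 0) (b : F) :
    ∑ x : F, quadraticChar F (a * x + b) = 0 := by
  rw [sum_affine (fun x => quadraticChar F x) ha, quadraticChar_sum_zero hF]

lemma sum_zz (hF : ringChar F ≠ 2) {c : F} (hc : c ≠ 0) :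
    ∑ z : F, quadraticChar F (z * (z - c)) = -1 := by
  have : ∀ z : F, quadraticChar F (z * (z - c)) =
      if z = 0 then 0 else quadraticChar F (-c * z⁻¹ + 1) := by
    intro z
    split_ifs with h
    · simp [h]
    · exact chi_eq h (by field_simp; ring)
  simp_rw [this]
  have h2 := sum_inv (fun z : F => if z = 0 then 0 else quadraticChar F (-c * z + 1))
  simp only [inv_eq_zero] at h2
  rw [h2, sum_ne, sum_chi_affine hF (neg_ne_zero.mpr hc)]
  simp

lemma sum_sq_sub (hF : ringChar F ≠ 2) (c : F) :
    ∑ x : F, quadraticChar F (x ^ 2 - c) = (if c = 0 then (Fintype.card F : ℤ) else 0) - 1 := by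
  split_ifs with h
  · subst h
    have : ∀ x : F, quadraticChar F (x ^ 2 - 0) = if x = 0 then 0 else 1 := by
      intro x
      split_ifs with h
      · simp [h]
      · rw [sub_zero, quadraticChar_sq_one' h]
    simp_rw [this]
    rw [sum_ne]; simp
  · rw [sum_sq hF (fun z => quadraticChar F (z - c))]
    simp_rw [mul_add, mul_one, Finset.sum_add_distrib, ← map_mul]
    have h1 := sum_chi_affine hF one_ne_zero (-c)
    simp_rw [one_mul, ← sub_eq_add_neg] at h1
    rw [h1]
    simp_rw [mul_comm (_ - c)]
    rw [sum_zz hF h]; simp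

lemma sum_quad (hF : ringChar F ≠ 2) {α : F} (hα : α ≠ 0) (β γ : F) :
    ∑ x : F, quadraticChar F (α * x ^ 2 + β * x + γ)
      = quadraticChar F α * ((if β ^ 2 - 4 * α * γ = 0 then (Fintype.card F : ℤ) else 0) - 1) := by
  have h2 := two_ne hF
  rw [← sum_sq_sub hF, ← sum_affine (fun x => quadraticChar F (x ^ 2 - _)) (mul_ne_zero h2 hα) β,
    Finset.mul_sum]
  refine Finset.sum_congr rfl fun x _ => ?_
  rw [← map_mul]
  symm
  exact chi_eq (mul_ne_zero h2 hα) (by ring)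

lemma sum_symm (hF : ringChar F ≠ 2) (f : F → F → ℤ) :
    ∑ x : F, ∑ y : F, f (x + y) (x * y) =
      ∑ s : F, ∑ q : F, f s q * (1 + quadraticChar F (s ^ 2 - 4 * q)) := by
  have h1 : ∀ x : F, ∑ y : F, f (x + y) (x * y) = ∑ s : F, f s (x * (s - x)) := fun x =>
    Fintype.sum_equiv (Equiv.addLeft x) _ _ (fun y => by simp)
  simp_rw [h1]
  rw [Finset.sum_comm]
  refine Finset.sum_congr rfl fun s _ => ?_
  have h2 : ∀ q : F, 1 + quadraticChar F (s ^ 2 - 4 * q) =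
      ∑ x : F, if x * (s - x) = q then (1 : ℤ) else 0 := by
    intro q
    have := cnt_quad hF one_ne_zero (-s) q
    rw [show (-s) ^ 2 - 4 * 1 * q = s ^ 2 - 4 * q by ring] at this
    rw [← this]
    refine Finset.sum_congr rfl fun x _ => ?_
    congr 1
    rw [eq_iff_iff]
    constructor <;> intro h <;> linear_combination -h
  simp_rw [h2, Finset.mul_sum]
  rw [Finset.sum_comm]
  refine Finset.sum_congr rfl fun x _ => ?_
  simp

/-- the fibre sum -/
noncomputable def hh (w : F) : ℤ :=
  ∑ t : F, quadraticChar F (t * (t ^ 2 - 2 * (1 + w) * t + (1 - w) ^ 2))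

noncomputable def gg (l : F) : ℤ :=
  ∑ u : F, ∑ v : F, quadraticChar F (u * v * (1 + u) * (1 + v) * (u * v + l))

lemma hh_eq (w : F) : hh w = ∑ s : F, quadraticChar F ((1 + s + w) * (s ^ 2 - 4 * w)) := by
  unfold hh
  rw [← sum_affine (fun t => quadraticChar F (t * (t ^ 2 - 2 * (1 + w) * t + (1 - w) ^ 2)))
    one_ne_zero (1 + w)]
  refine Finset.sum_congr rfl fun x _ => ?_
  congr 1; ring

lemma key_uv (hF : ringChar F ≠ 2) (k : F → F) :
    ∑ u : F, ∑ v : F, quadraticChar F ((1 + u) * (1 + v) * k (u * v)) =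
      ∑ w : F, quadraticChar F (k w) * hh w := by
  have := sum_symm hF (fun s w => quadraticChar F ((1 + s + w) * k w))
  have h2 : ∀ u v : F, (1 + u) * (1 + v) = 1 + (u + v) + u * v := by intros; ring
  simp_rw [h2]
  rw [this, Finset.sum_comm]
  refine Finset.sum_congr rfl fun w _ => ?_
  simp_rw [mul_add, mul_one, Finset.sum_add_distrib, hh_eq, Finset.mul_sum, map_mul]
  rw [← Finset.sum_mul]
  have := sum_chi_affine hF one_ne_zero (1 + w)
  have h3 : ∀ x : F, 1 + x + w = 1 * x + (1 + w) := by intros; ring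
  simp_rw [h3]
  rw [this, zero_mul, zero_add]
  refine Finset.sum_congr rfl fun x _ => ?_
  ring

lemma gg_eq (hF : ringChar F ≠ 2) (l : F) :
    gg l = ∑ w : F, quadraticChar F (w * (w + l)) * hh w := by
  rw [← key_uv hF (fun w => w * (w + l))]
  unfold gg
  refine Finset.sum_congr rfl fun x _ => Finset.sum_congr rfl fun y _ => ?_
  congr 1; ring

lemma sum_w_h (hF : ringChar F ≠ 2) : ∑ w : F, quadraticChar F w * hh w = 1 := by
  rw [← key_uv hF (fun w => w)]
  have : ∀ u v : F, quadraticChar F ((1 + u) * (1 + v) * (u * v)) =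
      quadraticChar F (u * (u - -1)) * quadraticChar F (v * (v - -1)) := by
    intro u v; rw [← map_mul]; congr 1; ring
  simp_rw [this]
  rw [← Finset.sum_mul_sum, sum_zz hF (by simp)]; norm_num

lemma hh_one (hF : ringChar F ≠ 2) : hh (1 : F) = - quadraticChar F (-1) := by
  unfold hh
  have h2 := two_ne hF
  have : ∀ t : F, quadraticChar F (t * (t ^ 2 - 2 * (1 + 1) * t + (1 - 1) ^ 2)) =
      if t = 0 then 0 else quadraticChar F (1 * t + -4) := by
    intro t
    split_ifs with h
    · simp [h]
    · exact chi_eq h (by ring)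
  simp_rw [this]
  rw [sum_ne, sum_chi_affine hF one_ne_zero]
  rw [zero_sub, chi_eq (x := -1) h2 (by ring)]

lemma gg_inv {l : F} (hl : l ≠ 0) : gg l⁻¹ = quadraticChar F l * gg l := by
  unfold gg
  rw [← sum_inv, Finset.mul_sum]
  refine Finset.sum_congr rfl fun u _ => ?_
  rw [← sum_inv, Finset.mul_sum]
  refine Finset.sum_congr rfl fun v _ => ?_
  rw [← map_mul]
  by_cases hu : u = 0
  · simp [hu]
  by_cases hv : v = 0
  · simp [hv]
  exact chi_eq (c := (u ^ 2 * v ^ 2 * l)⁻¹) (by positivity) (by field_simp; ring)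


lemma sum_r (hF : ringChar F ≠ 2) {b d : F} (hm : b ^ 2 - d ≠ 0) (f : F → ℤ) :
    ∑ r : F, (if r = -b then 0 else f ((r ^ 2 - d) / (r + b) ^ 2)) =
      ∑ w : F, f w * (1 + quadraticChar F (w * (b ^ 2 - d) + d) - if w = 1 then 1 else 0) := by
  have h2 := two_ne hF
  have h1 : ∀ w : F, (1 + quadraticChar F (w * (b ^ 2 - d) + d) - if w = 1 then (1 : ℤ) else 0) =
      ∑ r : F, if (1 - w) * r ^ 2 + (-2 * w * b) * r + -(d + w * b ^ 2) = 0 then (1 : ℤ) else 0 := by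
    intro w
    split_ifs with hw
    · subst hw
      rw [show (1 * (b ^ 2 - d) + d) = b ^ 2 by ring]
      by_cases hb : b = 0
      · subst hb
        have hd : d ≠ 0 := by simpa using hm
        simp [hd]
      · rw [quadraticChar_sq_one' hb]
        have : ∀ r : F, ((1 - 1) * r ^ 2 + (-2 * 1 * b) * r + -(d + 1 * b ^ 2) = 0) ↔
            r = -(d + b ^ 2) / (2 * b) := by
          intro r
          rw [eq_div_iff (mul_ne_zero h2 hb)]
          constructor <;> intro h <;> linear_combination -h
        simp_rw [this]
        simp
    · rw [cnt_quad hF (sub_ne_zero.mpr (Ne.symm hw)), sub_zero]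
      congr 1
      symm
      exact chi_eq h2 (by ring)
  simp_rw [h1, Finset.mul_sum]
  rw [Finset.sum_comm]
  refine Finset.sum_congr rfl fun r _ => ?_
  split_ifs with hr
  · subst hr
    symm
    apply Finset.sum_eq_zero
    intro w _
    rw [if_neg, mul_zero]
    intro h
    apply hm
    linear_combination h
  · have hr' : r + b ≠ 0 := fun h => hr (by linear_combination h)
    have : ∀ w : F, ((1 - w) * r ^ 2 + (-2 * w * b) * r + -(d + w * b ^ 2) = 0) ↔
        w = (r ^ 2 - d) / (r + b) ^ 2 := by
      intro w
      rw [eq_div_iff (pow_ne_zero 2 hr')]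
      constructor <;> intro h <;> linear_combination -h
    simp_rw [this]
    simp

lemma part1 (hF : ringChar F ≠ 2) {b d : F} (hm : b ^ 2 - d ≠ 0) (hd : d ≠ 0) :
    ∑ s : F, ∑ q : F, quadraticChar F ((q + b * s + b ^ 2) * ((q + d) ^ 2 - d * s ^ 2)) =
      Fintype.card F := by
  have h2 := two_ne hF
  have h1 : ∀ s : F, ∑ q : F, quadraticChar F ((q + b * s + b ^ 2) * ((q + d) ^ 2 - d * s ^ 2)) =
      ∑ q : F, quadraticChar F q * quadraticChar F ((b ^ 2 - d) * s ^ 2 +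
        (-2 * b * (q - (b ^ 2 - d))) * s + (q - (b ^ 2 - d)) ^ 2) := by
    intro s
    rw [← sum_affine (fun q => quadraticChar F ((q + b * s + b ^ 2) * ((q + d) ^ 2 - d * s ^ 2)))
      one_ne_zero (-(b * s + b ^ 2))]
    refine Finset.sum_congr rfl fun q _ => ?_
    rw [← map_mul]; congr 1; ring
  simp_rw [h1]
  rw [Finset.sum_comm]
  simp_rw [← Finset.mul_sum, sum_quad hF hm]
  have h3 : ∀ q : F, ((-2 * b * (q - (b ^ 2 - d))) ^ 2 -
      4 * (b ^ 2 - d) * (q - (b ^ 2 - d)) ^ 2 = 0) ↔ q = b ^ 2 - d := by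
    intro q
    rw [show (-2 * b * (q - (b ^ 2 - d))) ^ 2 - 4 * (b ^ 2 - d) * (q - (b ^ 2 - d)) ^ 2
      = 2 ^ 2 * d * (q - (b ^ 2 - d)) ^ 2 by ring]
    simp [h2, hd, sub_eq_zero]
  simp_rw [h3, mul_sub, Finset.sum_sub_distrib, mul_one, ← Finset.sum_mul,
    quadraticChar_sum_zero hF, ← mul_assoc]
  simp
  exact chi_mul_self hm

lemma fibre_r (hF : ringChar F ≠ 2) {b d r : F} (hr : r + b ≠ 0) :
    ∑ B : F, quadraticChar F (((r + b) * B + (b ^ 2 - d)) * (r ^ 2 - d) *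
      (B ^ 2 - 4 * r * B + 4 * d)) =
    quadraticChar F ((r ^ 2 - d) / (r + b) ^ 2) * hh ((r ^ 2 - d) / (r + b) ^ 2) := by
  unfold hh
  rw [← sum_affine (fun t => quadraticChar F (t * (t ^ 2 - 2 * (1 + (r ^ 2 - d) / (r + b) ^ 2) * t
    + (1 - (r ^ 2 - d) / (r + b) ^ 2) ^ 2))) (inv_ne_zero hr) ((b ^ 2 - d) / (r + b) ^ 2),
    Finset.mul_sum]
  refine Finset.sum_congr rfl fun B _ => ?_
  rw [← map_mul]
  apply chi_eq (c := (r + b) ^ 3) (pow_ne_zero 3 hr)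
  field_simp
  ring

lemma part2 (hF : ringChar F ≠ 2) {b d : F} (hm : b ^ 2 - d ≠ 0) (hd : d ≠ 0) :
    ∑ B : F, ∑ P : F, quadraticChar F ((P + b * B + b ^ 2) * ((P + d) ^ 2 - d * B ^ 2) *
      (B ^ 2 - 4 * P)) =
      (if b = 0 then Fintype.card F * quadraticChar F (-1) else 0) +
      ∑ w : F, quadraticChar F (w * (w * (b ^ 2 - d) + d)) * hh w := by
  have h2 := two_ne hF
  have h4 : (4 : F) ≠ 0 := by
    have : (4 : F) = 2 * 2 := by norm_num
    rw [this]; exact mul_ne_zero h2 h2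
  -- B = 0
  have hB0 : ∑ P : F, quadraticChar F ((P + b * 0 + b ^ 2) * ((P + d) ^ 2 - d * 0 ^ 2) *
      (0 ^ 2 - 4 * P)) = (if b = 0 then Fintype.card F * quadraticChar F (-1) else 0)
        - quadraticChar F (-1) - quadraticChar F ((b ^ 2 - d) * d) := by
    have e : ∀ P : F, quadraticChar F ((P + b * 0 + b ^ 2) * ((P + d) ^ 2 - d * 0 ^ 2) *
      (0 ^ 2 - 4 * P)) = if P = -d then 0 else
        quadraticChar F (-1 * P ^ 2 + (-b ^ 2) * P + 0) := by
      intro P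
      split_ifs with h
      · subst h; simp
      · have : P + d ≠ 0 := fun h' => h (by linear_combination h')
        exact chi_eq (mul_ne_zero h2 this) (by ring)
    simp_rw [e]
    rw [sum_ne, sum_quad hF (by simp)]
    have e3 : ((-b ^ 2) ^ 2 - 4 * (-1) * 0 = 0) ↔ b = 0 := by simp
    simp_rw [e3]
    rw [show -1 * (-d) ^ 2 + (-b ^ 2) * (-d) + 0 = (b ^ 2 - d) * d by ring]
    split_ifs <;> ring
  -- B ≠ 0
  have hB : ∀ B : F, B ≠ 0 → ∑ P : F, quadraticChar F ((P + b * B + b ^ 2) *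
      ((P + d) ^ 2 - d * B ^ 2) * (B ^ 2 - 4 * P)) =
      ∑ r : F, quadraticChar F (((r + b) * B + (b ^ 2 - d)) * (r ^ 2 - d) *
        (B ^ 2 - 4 * r * B + 4 * d)) := by
    intro B hB
    rw [← sum_affine (fun P => quadraticChar F ((P + b * B + b ^ 2) *
      ((P + d) ^ 2 - d * B ^ 2) * (B ^ 2 - 4 * P))) hB (-d)]
    refine Finset.sum_congr rfl fun r _ => ?_
    exact chi_eq hB (by ring)
  have hsplit : ∀ f : F → ℤ, ∑ B : F, f B = f 0 + ∑ B : F, if B = 0 then 0 else f B := by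
    intro f; rw [sum_ne]; ring
  rw [hsplit, hB0]
  have e1 : ∑ B : F, (if B = 0 then 0 else ∑ P : F, quadraticChar F ((P + b * B + b ^ 2) *
      ((P + d) ^ 2 - d * B ^ 2) * (B ^ 2 - 4 * P))) =
      ∑ r : F, ∑ B : F, if B = 0 then 0 else
        quadraticChar F (((r + b) * B + (b ^ 2 - d)) * (r ^ 2 - d) *
        (B ^ 2 - 4 * r * B + 4 * d)) := by
    rw [Finset.sum_comm]
    refine Finset.sum_congr rfl fun B _ => ?_
    split_ifs with h
    · simp
    · exact hB B h
  rw [e1]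
  simp_rw [sum_ne]
  rw [Finset.sum_sub_distrib]
  have e2 : ∑ r : F, quadraticChar F (((r + b) * 0 + (b ^ 2 - d)) * (r ^ 2 - d) *
        (0 ^ 2 - 4 * r * 0 + 4 * d)) = - quadraticChar F ((b ^ 2 - d) * d) := by
    have : ∀ r : F, quadraticChar F (((r + b) * 0 + (b ^ 2 - d)) * (r ^ 2 - d) *
        (0 ^ 2 - 4 * r * 0 + 4 * d)) = quadraticChar F ((b ^ 2 - d) * d) *
        quadraticChar F (r ^ 2 - d) := by
      intro r
      rw [← map_mul]
      exact chi_eq h2 (by ring)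
    simp_rw [this, ← Finset.mul_sum]
    rw [sum_sq_sub hF, if_neg hd]; ring
  rw [e2]
  have e3 : ∑ r : F, ∑ B : F, quadraticChar F (((r + b) * B + (b ^ 2 - d)) * (r ^ 2 - d) *
        (B ^ 2 - 4 * r * B + 4 * d)) = -1 + ∑ r : F, if r = -b then 0 else
          quadraticChar F ((r ^ 2 - d) / (r + b) ^ 2) * hh ((r ^ 2 - d) / (r + b) ^ 2) := by
    have hs : ∀ f : F → ℤ, ∑ r : F, f r = f (-b) + ∑ r : F, if r = -b then 0 else f r := by
      intro f; rw [sum_ne]; ring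
    rw [hs]
    congr 1
    · have : ∀ B : F, quadraticChar F (((-b + b) * B + (b ^ 2 - d)) * ((-b) ^ 2 - d) *
        (B ^ 2 - 4 * (-b) * B + 4 * d)) = quadraticChar F (1 * B ^ 2 + 4 * b * B + 4 * d) := by
        intro B
        exact chi_eq hm (by ring)
      simp_rw [this]
      rw [sum_quad hF one_ne_zero, if_neg]
      · simp
      · rw [show (4 * b) ^ 2 - 4 * 1 * (4 * d) = 4 * 4 * (b ^ 2 - d) by ring]
        exact mul_ne_zero (mul_ne_zero h4 h4) hm
    · refine Finset.sum_congr rfl fun r _ => ?_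
      split_ifs with h
      · rfl
      · exact fibre_r hF (fun h' => h (by linear_combination h'))
  rw [e3, sum_r hF hm (fun w => quadraticChar F w * hh w)]
  simp_rw [mul_sub, mul_add, Finset.sum_sub_distrib, Finset.sum_add_distrib, mul_one]
  rw [sum_w_h hF]
  have e4 : ∑ w : F, quadraticChar F w * hh w * (if w = 1 then 1 else 0) =
      - quadraticChar F (-1) := by
    simp [hh_one hF]
  have e5 : ∑ w : F, quadraticChar F w * hh w * quadraticChar F (w * (b ^ 2) - w * d + d) =
      ∑ w : F, quadraticChar F (w * (w * b ^ 2 - w * d + d)) * hh w := by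
    refine Finset.sum_congr rfl fun w _ => ?_
    rw [map_mul]; ring
  rw [e4, e5]
  simp only [mul_sub, mul_add]
  ring

lemma main_bd (hF : ringChar F ≠ 2) {b d : F} (hm : b ^ 2 - d ≠ 0) (hd : d ≠ 0) :
    (∑ x : F, quadraticChar F (x * (x ^ 2 - 2 * b * x + (b ^ 2 - d)))) ^ 2 =
      Fintype.card F + (if b = 0 then Fintype.card F * quadraticChar F (-1) else 0) +
      ∑ w : F, quadraticChar F (w * (w * (b ^ 2 - d) + d)) * hh w := by
  rw [add_assoc, ← part2 hF hm hd, ← part1 hF hm hd]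
  rw [← sum_affine (fun x => quadraticChar F (x * (x ^ 2 - 2 * b * x + (b ^ 2 - d))))
    one_ne_zero b, sq, Finset.sum_mul_sum]
  have := sum_symm hF (fun s q => quadraticChar F ((q + b * s + b ^ 2) *
    ((q + d) ^ 2 - d * s ^ 2)))
  simp_rw [mul_add (quadraticChar F _), mul_one, Finset.sum_add_distrib, ← map_mul] at this
  rw [← this]
  refine Finset.sum_congr rfl fun x _ => Finset.sum_congr rfl fun y _ => ?_
  rw [← map_mul]; congr 1; ring

lemma curve_l (hF : ringChar F ≠ 2) {l : F} (hl : l ≠ 0) (hl1 : l + 1 ≠ 0) :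
    (∑ x : F, quadraticChar F (x ^ 3 - 2 * x ^ 2 + l / (l + 1) * x)) ^ 2 =
      Fintype.card F + quadraticChar F (l + 1) * gg l := by
  have hm : (1 : F) ^ 2 - 1 / (l + 1) = l / (l + 1) := by field_simp; ring
  have hd : 1 / (l + 1) ≠ 0 := one_div_ne_zero hl1
  have h := main_bd hF (b := 1) (d := 1 / (l + 1)) (by rw [hm]; exact div_ne_zero hl hl1) hd
  rw [hm, if_neg one_ne_zero, add_zero] at h
  have e : quadraticChar F (l + 1) * gg l = quadraticChar F (l * (l + 1)) * gg l⁻¹ := by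
    rw [gg_inv hl, map_mul]
    linear_combination -(quadraticChar F (l + 1) * gg l) * chi_mul_self hl
  rw [e, gg_eq hF, Finset.mul_sum]
  convert h using 2
  · refine Finset.sum_congr rfl fun x _ => ?_
    congr 1; ring
  · refine Finset.sum_congr rfl fun w _ => ?_
    rw [← mul_assoc, ← map_mul]
    congr 1
    exact chi_eq hl1 (by field_simp)

lemma curve_neg (hF : ringChar F ≠ 2) (h1 : quadraticChar F (-1) = 1) :
    (∑ x : F, quadraticChar F (x ^ 3 - x)) ^ 2 = 2 * Fintype.card F + gg (-1 : F) := by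
  have h := main_bd hF (b := (0 : F)) (d := 1) (by simp) one_ne_zero
  rw [if_pos rfl, h1] at h
  rw [gg_eq hF]
  convert h using 2
  · refine Finset.sum_congr rfl fun x _ => ?_
    congr 1; ring
  · ring
  · refine Finset.sum_congr rfl fun w _ => ?_
    congr 1
    rw [← one_mul (quadraticChar F (w * (w + -1))), ← h1, ← map_mul]
    congr 1; ring

/-- number of points on `y² = f x` -/
lemma card_curve (hF : ringChar F ≠ 2) (f : F → F) :
    (Nat.card {xy : F × F // xy.2 ^ 2 = f xy.1} : ℤ) =
      Fintype.card F + ∑ x : F, quadraticChar F (f x) := by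
  rw [Nat.card_eq_fintype_card, Fintype.card_subtype, Finset.card_filter]
  push_cast
  rw [Fintype.sum_prod_type]
  simp_rw [cnt_sq hF, Finset.sum_add_distrib]
  simp

/-- three-step path sum -/
noncomputable def PP (x y : F) : ℤ :=
  ∑ a : F, ∑ c : F, quadraticChar F (x * (x + a) * (a * (a + c)) * (c * (c + y)))

lemma PP_eq {x l : F} (hx : x ≠ 0) : PP x (x * l) = gg l := by
  unfold PP gg
  rw [← sum_affine _ hx 0]
  refine Finset.sum_congr rfl fun u _ => ?_
  by_cases hu : u = 0
  · simp [hu]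
  rw [← sum_affine _ (mul_ne_zero hx hu) 0]
  refine Finset.sum_congr rfl fun v _ => ?_
  exact chi_eq (c := x ^ 3 * u) (mul_ne_zero (pow_ne_zero 3 hx) hu) (by ring)

lemma PP_zero (y : F) : PP 0 y = 0 := by simp [PP]

lemma sum_PP : ∑ x : F, ∑ y : F, PP x y * PP y x =
    (Fintype.card F - 1) * ∑ l : F, quadraticChar F l * gg l ^ 2 := by
  have h : ∀ x : F, ∑ y : F, PP x y * PP y x =
      if x = 0 then 0 else ∑ l : F, quadraticChar F l * gg l ^ 2 := by
    intro x
    split_ifs with hx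
    · subst hx; simp [PP_zero]
    · rw [← sum_affine _ hx 0]
      refine Finset.sum_congr rfl fun l _ => ?_
      rw [add_zero, PP_eq hx]
      by_cases hl : l = 0
      · subst hl; simp [PP_zero]
      · have := PP_eq (l := l⁻¹) (mul_ne_zero hx hl)
        rw [mul_assoc, mul_inv_cancel₀ hl, mul_one] at this
        rw [this, gg_inv hl]; ring
  simp_rw [h]
  rw [sum_ne (f := fun _ : F => ∑ l : F, quadraticChar F l * gg l ^ 2)]
  simp
  ring

lemma sum_six (f : (Fin 6 → F) → ℤ) : ∑ v : Fin 6 → F, f v =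
    ∑ x0 : F, ∑ x1 : F, ∑ x2 : F, ∑ x3 : F, ∑ x4 : F, ∑ x5 : F, f ![x0, x1, x2, x3, x4, x5] := by
  have h : ∀ (n : ℕ) (f : (Fin (n + 1) → F) → ℤ), ∑ v : Fin (n + 1) → F, f v =
      ∑ x : F, ∑ v : Fin n → F, f (Matrix.vecCons x v) := by
    intro n f
    rw [← (Fin.consEquiv (fun _ : Fin (n + 1) => F)).sum_comp, Fintype.sum_prod_type]
    rfl
  simp_rw [h]
  simp only [Finset.univ_unique, Finset.sum_singleton,
    Subsingleton.elim (default : Fin 0 → F) ![]]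

lemma sum_prod_six : ∑ v : Fin 6 → F, quadraticChar F (∏ i : Fin 6, v i * (v i + v (i + 1))) =
    (Fintype.card F - 1) * ∑ l : F, quadraticChar F l * gg l ^ 2 := by
  rw [← sum_PP, sum_six]
  refine Finset.sum_congr rfl fun x0 _ => ?_
  have h : ∀ x3 : F, PP x0 x3 * PP x3 x0 = ∑ x1 : F, ∑ x2 : F, ∑ x4 : F, ∑ x5 : F,
      quadraticChar F (∏ i : Fin 6, ![x0, x1, x2, x3, x4, x5] i *
        (![x0, x1, x2, x3, x4, x5] i + ![x0, x1, x2, x3, x4, x5] (i + 1))) := by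
    intro x3
    unfold PP
    simp_rw [Finset.sum_mul, Finset.mul_sum]
    refine Finset.sum_congr rfl fun x1 _ => Finset.sum_congr rfl fun x2 _ =>
      Finset.sum_congr rfl fun x4 _ => Finset.sum_congr rfl fun x5 _ => ?_
    rw [← map_mul]
    congr 1
    rw [Fin.prod_univ_six]
    change _ = x0 * (x0 + x1) * (x1 * (x1 + x2)) * (x2 * (x2 + x3)) * (x3 * (x3 + x4)) *
      (x4 * (x4 + x5)) * (x5 * (x5 + x0))
    ring
  simp_rw [h]
  rw [Finset.sum_comm (s := (Finset.univ : Finset F)) (t := (Finset.univ : Finset F))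
    (f := fun x3 x1 => ∑ x2 : F, ∑ x4 : F, ∑ x5 : F,
      quadraticChar F (∏ i : Fin 6, ![x0, x1, x2, x3, x4, x5] i *
        (![x0, x1, x2, x3, x4, x5] i + ![x0, x1, x2, x3, x4, x5] (i + 1))))]
  refine Finset.sum_congr rfl fun x1 _ => ?_
  exact Finset.sum_comm

lemma card_six (hF : ringChar F ≠ 2) :
    (Nat.card {v : F × (Fin 6 → F) // v.2 ≠ 0 ∧
        v.1 ^ 2 = ∏ i : Fin 6, v.2 i * (v.2 i + v.2 (i + 1))} : ℤ) =
      (Fintype.card F : ℤ) ^ 6 - 1 +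
      (Fintype.card F - 1) * ∑ l : F, quadraticChar F l * gg l ^ 2 := by
  classical
  rw [← sum_prod_six, Nat.card_eq_fintype_card, Fintype.card_subtype, Finset.card_filter]
  push_cast
  rw [Fintype.sum_prod_type_right]
  have : ∀ v : Fin 6 → F, ∑ t : F, (if v ≠ 0 ∧ t ^ 2 = ∏ i : Fin 6, v i * (v i + v (i + 1))
      then (1 : ℤ) else 0) = 1 + quadraticChar F (∏ i : Fin 6, v i * (v i + v (i + 1)))
        - if v = 0 then 1 else 0 := by
    intro v
    by_cases hv : v = 0
    · subst hv; simp
    · simp only [hv, ne_eq, not_false_eq_true, true_and, if_false, sub_zero]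
      exact cnt_sq hF _
  simp_rw [this, Finset.sum_sub_distrib, Finset.sum_add_distrib]
  simp
  ring

lemma gg_neg_one_zero (h : quadraticChar F (-1) = -1) : gg (-1 : F) = 0 := by
  have := gg_inv (l := (-1 : F)) (by simp)
  rw [h, inv_neg, inv_one] at this
  omega

end helpers

theorem statement10 (p : ℕ) [Fact p.Prime] (hodd : Odd p)
    (aneg : ℤ)
    (haneg : aneg = p - Nat.card {xy : ZMod p × ZMod p // xy.2 ^ 2 = xy.1 ^ 3 - xy.1})
    (eps : ℤ)
    (heps1 : p % 4 = 1 → eps = (2 * p - aneg ^ 2) ^ 2)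
    (heps3 : p % 4 = 3 → eps = 0) :
    (Nat.card {v : ZMod p × (Fin 6 → ZMod p) // v.2 ≠ 0 ∧
        v.1 ^ 2 = ∏ i : Fin 6, v.2 i * (v.2 i + v.2 (i + 1))} : ℤ) =
      (p - 1) * ((∑ i ∈ Finset.range 6, (p : ℤ) ^ i) + eps +
        ∑ lam ∈ Finset.univ.filter (fun lam : ZMod p => lam ≠ 0 ∧ lam ≠ -1),
          quadraticChar (ZMod p) lam *
            (((p : ℤ) - Nat.card {xy : ZMod p × ZMod p //
              xy.2 ^ 2 = xy.1 ^ 3 - 2 * xy.1 ^ 2 + (lam / (lam + 1)) * xy.1}) ^ 2 - p) ^ 2) := by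
  have hp2 : p ≠ 2 := by rintro rfl; exact absurd hodd (by decide)
  have hF : ringChar (ZMod p) ≠ 2 := by rwa [ZMod.ringChar_zmod_n]
  have hchi : quadraticChar (ZMod p) (-1) = ZMod.χ₄ p := by
    rw [quadraticChar_neg_one hF, ZMod.card]
  have heps : eps = quadraticChar (ZMod p) (-1) * gg (-1 : ZMod p) ^ 2 := by
    have h4 : p % 4 = 1 ∨ p % 4 = 3 := by
      have := Nat.odd_iff.mp hodd; omega
    rcases h4 with h4 | h4
    · have h1 : quadraticChar (ZMod p) (-1) = 1 := by rw [hchi, ZMod.χ₄_nat_one_mod_four h4]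
      have hc := curve_neg hF h1
      rw [ZMod.card] at hc
      rw [heps1 h4, haneg, card_curve hF (fun x => x ^ 3 - x), h1, ZMod.card]
      rw [show (p : ℤ) - (p + ∑ x : ZMod p, quadraticChar (ZMod p) (x ^ 3 - x)) =
        - ∑ x : ZMod p, quadraticChar (ZMod p) (x ^ 3 - x) by ring, neg_sq, hc]
      ring
    · have h1 : quadraticChar (ZMod p) (-1) = -1 := by rw [hchi, ZMod.χ₄_nat_three_mod_four h4]
      rw [heps3 h4, gg_neg_one_zero h1]; simp
  have hterm : ∑ lam ∈ Finset.univ.filter (fun lam : ZMod p => lam ≠ 0 ∧ lam ≠ -1),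
          quadraticChar (ZMod p) lam *
            (((p : ℤ) - Nat.card {xy : ZMod p × ZMod p //
              xy.2 ^ 2 = xy.1 ^ 3 - 2 * xy.1 ^ 2 + (lam / (lam + 1)) * xy.1}) ^ 2 - p) ^ 2 =
      ∑ lam ∈ Finset.univ.filter (fun lam : ZMod p => lam ≠ 0 ∧ lam ≠ -1),
          quadraticChar (ZMod p) lam * gg lam ^ 2 := by
    refine Finset.sum_congr rfl fun l hl => ?_
    obtain ⟨hl0, hl1⟩ := (Finset.mem_filter.mp hl).2
    have hl1' : l + 1 ≠ 0 := fun h => hl1 (by linear_combination h)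
    have hc := curve_l hF hl0 hl1'
    rw [ZMod.card] at hc
    rw [card_curve hF (fun x => x ^ 3 - 2 * x ^ 2 + (l / (l + 1)) * x), ZMod.card]
    rw [sub_add_cancel_left, neg_sq, hc, add_sub_cancel_left, mul_pow,
      quadraticChar_sq_one hl1', one_mul]
  have hsum : ∑ l : ZMod p, quadraticChar (ZMod p) l * gg l ^ 2 = eps +
      ∑ lam ∈ Finset.univ.filter (fun lam : ZMod p => lam ≠ 0 ∧ lam ≠ -1),
          quadraticChar (ZMod p) lam * gg lam ^ 2 := by
    rw [heps, ← Finset.sum_filter_add_sum_filter_not Finset.univ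
      (fun lam : ZMod p => lam ≠ 0 ∧ lam ≠ -1), add_comm]
    congr 1
    apply Finset.sum_eq_single_of_mem
    · simp
    · intro l hl hne
      have := (Finset.mem_filter.mp hl).2
      have h0 : l = 0 := by tauto
      simp [h0]
  rw [card_six hF, ZMod.card, hterm, hsum]
  simp only [Finset.sum_range_succ, Finset.sum_range_zero]
  ring
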